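/- Let K be a field, I ⊆ K[x₁,…,xₙ] a primary ideal, J ⊆ {1,…,n} a maximal subset with I ∩ K[x_j : j ∈ J] = {0}, k the fraction field of K[J], R = k[x_a : a ∉ J], and Iᴱ = R·I the extension of I. Then Iᴱ ∩ K[x₁,…,xₙ] = I. -/

import Mathlib

/-- Let `I ⊆ K[x₁,…,xₙ]` be primary, `J` a maximal set of variables with
`I ∩ K[x_j : j ∈ J] = {0}`, `k` the fraction field of `K[J]`, `R = k[x_a : a ∉ J]`,
and `Iᴱ = R·I` the extension of `I` along the natural map `K[X] → R`.
Then `Iᴱ ∩ K[X] = I`. -/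
theorem stmt_7 {K : Type*} [Field K] (n : ℕ)
    (I : Ideal (MvPolynomial (Fin n) K)) (hI : I.IsPrimary) (J : Set (Fin n))
    [∀ i, Decidable (i ∈ J)]
    (hJmax : Maximal
      (fun J' : Set (Fin n) => ∀ f ∈ I, f ∈ MvPolynomial.supported K J' → f = 0) J)
    (φ : MvPolynomial (Fin n) K →+*
      MvPolynomial (↥Jᶜ) (FractionRing (MvPolynomial (↥J) K)))
    (hφ : φ = MvPolynomial.eval₂Hom
      ((MvPolynomial.C : FractionRing (MvPolynomial (↥J) K) →+* _).comp
        ((algebraMap (MvPolynomial (↥J) K) (FractionRing (MvPolynomial (↥J) K))).comp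
          (MvPolynomial.C : K →+* MvPolynomial (↥J) K)))
      (fun i => if h : i ∈ J then
          MvPolynomial.C (algebraMap (MvPolynomial (↥J) K)
            (FractionRing (MvPolynomial (↥J) K)) (MvPolynomial.X (⟨i, h⟩ : ↥J)))
        else MvPolynomial.X (⟨i, h⟩ : ↥Jᶜ))) :
    Ideal.comap φ (Ideal.map φ I) = I := by
  classical
  let _ := MvPolynomial.algebraMvPolynomial (σ := ↥Jᶜ) (R := MvPolynomial (↥J) K)
    (S := FractionRing (MvPolynomial (↥J) K))
  let e : MvPolynomial (Fin n) K ≃ₐ[K] MvPolynomial (↥Jᶜ) (MvPolynomial (↥J) K) :=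
    (MvPolynomial.renameEquiv K
      ((Equiv.Set.sumCompl J).symm.trans (Equiv.sumComm _ _))).trans
      (MvPolynomial.sumAlgEquiv K (↥Jᶜ) (↥J))
  have heJ : ∀ i (h : i ∈ J), e (MvPolynomial.X i) = MvPolynomial.C (MvPolynomial.X ⟨i, h⟩) := by
    intro i h
    simp [e, Equiv.Set.sumCompl_symm_apply_of_mem h]
  have heJc : ∀ i (h : i ∉ J), e (MvPolynomial.X i) = MvPolynomial.X ⟨i, h⟩ := by
    intro i h
    simp [e, Equiv.Set.sumCompl_symm_apply_of_notMem h]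
  have heC : ∀ a : K, e (MvPolynomial.C a) = MvPolynomial.C (MvPolynomial.C a) := by
    intro a
    simp [e]
  have hfac : φ = (algebraMap (MvPolynomial (↥Jᶜ) (MvPolynomial (↥J) K)) (MvPolynomial (↥Jᶜ) (FractionRing (MvPolynomial (↥J) K)))).comp
      (e : MvPolynomial (Fin n) K →+* MvPolynomial (↥Jᶜ) (MvPolynomial (↥J) K)) := by
    rw [hφ, MvPolynomial.algebraMap_def]
    apply MvPolynomial.ringHom_ext
    · intro a
      simp [heC]
    · intro i
      by_cases h : i ∈ J
      · simp [heJ i h, h]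
      · simp [heJc i h, h]
  have heR : ∀ p : (MvPolynomial (↥J) K), e (MvPolynomial.rename Subtype.val p) = MvPolynomial.C p := by
    intro p
    have : ((e : MvPolynomial (Fin n) K →+* MvPolynomial (↥Jᶜ) (MvPolynomial (↥J) K)).comp
      (MvPolynomial.rename (R := K) (Subtype.val : ↥J → Fin n) :
        (MvPolynomial (↥J) K) →+* MvPolynomial (Fin n) K)) = (MvPolynomial.C : (MvPolynomial (↥J) K) →+* _) := by
      apply MvPolynomial.ringHom_ext
      · intro a
        simp [heC]
      · intro i
        simp [heJ i.1 i.2]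
    exact congrArg (fun g : (MvPolynomial (↥J) K) →+* _ => g p) this
  refine le_antisymm ?_ Ideal.le_comap_map
  intro f hf
  rw [Ideal.mem_comap, hfac, ← Ideal.map_map, RingHom.comp_apply,
    IsLocalization.algebraMap_mem_map_algebraMap_iff
      ((nonZeroDivisors (MvPolynomial (↥J) K)).map (MvPolynomial.C : (MvPolynomial (↥J) K) →+* MvPolynomial (↥Jᶜ) (MvPolynomial (↥J) K)))] at hf
  obtain ⟨_, ⟨p, hp, rfl⟩, hm⟩ := hf
  have hp0 : p ≠ 0 := nonZeroDivisors.ne_zero hp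
  have hm2 : f * MvPolynomial.rename Subtype.val p ∈ I := by
    obtain ⟨g, hg, hge⟩ := (Ideal.mem_map_iff_of_surjective
      (e : MvPolynomial (Fin n) K →+* MvPolynomial (↥Jᶜ) (MvPolynomial (↥J) K)) e.surjective).1 hm
    have : g = f * MvPolynomial.rename Subtype.val p := by
      apply e.injective
      rw [map_mul, heR, mul_comm]
      exact hge
    rwa [← this]
  rcases (Ideal.isPrimary_iff.1 hI).2 hm2 with h | ⟨m, h⟩
  · exact h
  · exfalso
    rw [← map_pow] at h
    have h0 := hJmax.prop _ h (by
      rw [MvPolynomial.supported_eq_range_rename]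
      exact ⟨_, rfl⟩)
    rw [← map_zero (MvPolynomial.rename (R := K) (Subtype.val : ↥J → Fin n))] at h0
    exact hp0 (eq_zero_of_pow_eq_zero (MvPolynomial.rename_injective _ Subtype.val_injective h0))
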